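/- Let G be an ordered mean, 𝔸 = [Aᵢⱼ] an n×k array of positive definite operators with mI ≤ Aᵢⱼ ≤ MI, and μ₁,…,μₙ, ν ≥ 0. Then G^ν_n(ω; G^{μ₁}ₖ(λ; 𝔸¹), …, G^{μₙ}ₖ(λ; 𝔸ⁿ)) ≤ K·G^{ω•μ}ₖ(λ; G^ν_n(ω; 𝔸₁), …, G^ν_n(ω; 𝔸ₖ)), where K = (M+m)²/(4Mm) and ω•μ = ∑ᵢ wᵢμᵢ. -/

import Mathlib

open ContinuousLinearMap in
/-- A positive definite (positive invertible) bounded operator on a Hilbert space. -/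
def IsPosDef {H : Type*} [NormedAddCommGroup H] [InnerProductSpace ℂ H] [CompleteSpace H]
    (A : H →L[ℂ] H) : Prop := A.IsPositive ∧ IsUnit A

/-- A positive probability vector. -/
def IsProbVec {n : ℕ} (w : Fin n → ℝ) : Prop := (∀ i, 0 < w i) ∧ ∑ i, w i = 1

/-- An ordered mean: a family of weighted means of positive definite operators satisfying
homogeneity, monotonicity, joint concavity and the arithmetic-`G`-harmonic mean inequalities
with respect to the Loewner order. -/
structure OrderedMean (H : Type*) [NormedAddCommGroup H] [InnerProductSpace ℂ H]
    [CompleteSpace H] where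
  G : ∀ n : ℕ, (Fin n → ℝ) → (Fin n → (H →L[ℂ] H)) → (H →L[ℂ] H)
  posDef : ∀ n w A, IsProbVec w → (∀ i, IsPosDef (A i)) → IsPosDef (G n w A)
  homog : ∀ n w A (a : ℝ), IsProbVec w → (∀ i, IsPosDef (A i)) → 0 < a →
    G n w (fun i => a • A i) = a • G n w A
  mono : ∀ n w A B, IsProbVec w → (∀ i, IsPosDef (A i)) → (∀ i, IsPosDef (B i)) →
    (∀ i, B i ≤ A i) → G n w B ≤ G n w A
  concave : ∀ n w A B (s : ℝ), IsProbVec w → (∀ i, IsPosDef (A i)) → (∀ i, IsPosDef (B i)) →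
    0 ≤ s → s ≤ 1 →
    (1 - s) • G n w A + s • G n w B ≤ G n w (fun i => (1 - s) • A i + s • B i)
  harm_le : ∀ n w A, IsProbVec w → (∀ i, IsPosDef (A i)) →
    Ring.inverse (∑ i, w i • Ring.inverse (A i)) ≤ G n w A
  le_arith : ∀ n w A, IsProbVec w → (∀ i, IsPosDef (A i)) →
    G n w A ≤ ∑ i, w i • A i

/-- The parameterized ordered mean `G^μ`. -/
noncomputable def OrderedMean.pMean {H : Type*} [NormedAddCommGroup H] [InnerProductSpace ℂ H]
    [CompleteSpace H] (G : OrderedMean H) (μ : ℝ) (n : ℕ) (w : Fin n → ℝ)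
    (A : Fin n → (H →L[ℂ] H)) : H →L[ℂ] H :=
  if 0 ≤ μ then G.G n w (fun i => A i + μ • 1) - μ • 1
  else Ring.inverse (G.G n w (fun i => Ring.inverse (A i) + (-μ) • 1) - (-μ) • 1)

/-- The constant `ρ_{M,m}(t)`. -/
noncomputable def rhoConst (M m t : ℝ) : ℝ :=
  if M / m ≤ t then (1 - t) * m
  else if t ≤ m / M then (1 - t) * M
  else M + m - 2 * Real.sqrt (t * M * m)

variable {H : Type*} [NormedAddCommGroup H] [InnerProductSpace ℂ H] [CompleteSpace H]

theorem isPosDef_iff_isStrictlyPositive {A : H →L[ℂ] H} : IsPosDef A ↔ IsStrictlyPositive A := by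
  rw [IsPosDef, IsStrictlyPositive, ContinuousLinearMap.nonneg_iff_isPositive]

theorem smul_sub_mul_mul_sub_eq {R : Type*} [Ring R] [Algebra ℝ R] {S T : R}
    (hST : S * T = 1) (hTS : T * S = 1) {m M : ℝ} (hm : m ≠ 0) (hM : M ≠ 0) :
    (1 / (4 * M * m)) • (((M + m) • 1 - (2 * M * m) • S) * T * ((M + m) • 1 - (2 * M * m) • S)) =
      ((M + m) ^ 2 / (4 * M * m)) • T - ((M + m) • 1 - (M * m) • S) := by
  simp only [sub_mul, mul_sub, smul_mul_assoc, mul_smul_comm, one_mul, mul_one, hST, hTS]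
  match_scalars <;> field_simp <;> ring

namespace IsPosDef

theorem nonneg {A : H →L[ℂ] H} (hA : IsPosDef A) : 0 ≤ A :=
  (isPosDef_iff_isStrictlyPositive.1 hA).nonneg

theorem of_le {A B : H →L[ℂ] H} (hA : IsPosDef A) (h : A ≤ B) : IsPosDef B :=
  isPosDef_iff_isStrictlyPositive.2 ((isPosDef_iff_isStrictlyPositive.1 hA).of_le h)

theorem add_nonneg {A B : H →L[ℂ] H} (hA : IsPosDef A) (hB : 0 ≤ B) : IsPosDef (A + B) :=
  hA.of_le (le_add_of_nonneg_right hB)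

theorem smul {A : H →L[ℂ] H} (hA : IsPosDef A) {c : ℝ} (hc : 0 < c) : IsPosDef (c • A) :=
  isPosDef_iff_isStrictlyPositive.2
    ⟨smul_nonneg hc.le hA.nonneg, hA.2.smul (Units.mk0 c hc.ne')⟩

theorem one : IsPosDef (1 : H →L[ℂ] H) :=
  isPosDef_iff_isStrictlyPositive.2 ⟨zero_le_one, isUnit_one⟩

theorem add_smul_one {A : H →L[ℂ] H} (hA : IsPosDef A) {c : ℝ} (hc : 0 ≤ c) :
    IsPosDef (A + c • 1) :=
  hA.add_nonneg (smul_nonneg hc zero_le_one)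

theorem ringInverse {A : H →L[ℂ] H} (hA : IsPosDef A) : IsPosDef (Ring.inverse A) :=
  isPosDef_iff_isStrictlyPositive.2 (isPosDef_iff_isStrictlyPositive.1 hA).ringInverse

theorem sum {ι : Type*} {s : Finset ι} (hs : s.Nonempty) {A : ι → H →L[ℂ] H}
    (hA : ∀ i ∈ s, IsPosDef (A i)) : IsPosDef (∑ i ∈ s, A i) := by
  obtain ⟨i, hi⟩ := hs
  exact (hA i hi).of_le (Finset.single_le_sum (fun j hj => (hA j hj).nonneg) hi)

/-- An operator with `m ≤ A ≤ M` satisfies `A + M m A⁻¹ ≤ M + m`. -/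
theorem add_smul_inverse_le {A : H →L[ℂ] H} (hA : IsPosDef A) {m M : ℝ}
    (hm : m • (1 : H →L[ℂ] H) ≤ A) (hM : A ≤ M • (1 : H →L[ℂ] H)) :
    A + (M * m) • Ring.inverse A ≤ (M + m) • (1 : H →L[ℂ] H) := by
  have hAB := Ring.mul_inverse_cancel A hA.2
  have hBA := Ring.inverse_mul_cancel A hA.2
  set B := Ring.inverse A
  have hcomm : Commute A B := hAB.trans hBA.symm
  have hsub (c : ℝ) (X : H →L[ℂ] H) : Commute X (c • 1 : H →L[ℂ] H) :=
    (Commute.one_right X).smul_right c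
  have h₁ : Commute (M • 1 - A) (A - m • 1) :=
    ((hsub M A).symm.sub_left (Commute.refl A)).sub_right (hsub m _)
  have h₂ : Commute ((M • 1 - A) * (A - m • 1)) B :=
    (((hsub M B).symm.sub_left hcomm).mul_left (hcomm.sub_left (hsub m B).symm))
  have h := Commute.mul_nonneg (Commute.mul_nonneg (sub_nonneg.2 hM) (sub_nonneg.2 hm) h₁)
    hA.ringInverse.nonneg h₂
  rw [← sub_nonneg]
  convert h using 1
  have : (M • 1 - A) * (A - m • 1) * B = M • (A * B) - (M * m) • B - A * (A * B) + m • (A * B) := by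
    simp only [sub_mul, mul_sub, smul_mul_assoc, mul_smul_comm, one_mul, mul_one, mul_assoc]
    module
  rw [this, hAB, mul_one]
  module

/-- `(M + m) - M m S` lies below the Kantorovich constant times `S⁻¹`. -/
theorem smul_one_sub_smul_le_smul_inverse {S : H →L[ℂ] H} (hS : IsPosDef S) {m M : ℝ}
    (hm : 0 < m) (hM : 0 < M) :
    (M + m) • (1 : H →L[ℂ] H) - (M * m) • S ≤
      ((M + m) ^ 2 / (4 * M * m)) • Ring.inverse S := by
  have hST := Ring.mul_inverse_cancel S hS.2
  have hTS := Ring.inverse_mul_cancel S hS.2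
  have hT := hS.ringInverse.nonneg
  set T := Ring.inverse S
  have hsa : IsSelfAdjoint ((M + m) • (1 : H →L[ℂ] H) - (2 * M * m) • S) := by
    have h1 : IsSelfAdjoint ((M + m) • (1 : H →L[ℂ] H)) :=
      .of_nonneg (smul_nonneg (by positivity) zero_le_one)
    have h2 : IsSelfAdjoint ((2 * M * m) • S) :=
      .of_nonneg (smul_nonneg (by positivity) hS.nonneg)
    exact h1.sub h2
  have hc : (0 : ℝ) ≤ 1 / (4 * M * m) := by positivity
  have h := smul_nonneg hc (hsa.conjugate_nonneg hT)
  rw [smul_sub_mul_mul_sub_eq hST hTS hm.ne' hM.ne'] at h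
  exact sub_nonneg.1 h

end IsPosDef

/-- The operator Kantorovich inequality between the weighted arithmetic and harmonic means. -/
theorem sum_smul_le_kantorovich_smul_harmonic {n : ℕ} {w : Fin n → ℝ} (hw : IsProbVec w)
    {A : Fin n → H →L[ℂ] H} (hA : ∀ i, IsPosDef (A i)) {m M : ℝ} (hm : 0 < m) (hM : 0 < M)
    (hbd : ∀ i, m • (1 : H →L[ℂ] H) ≤ A i ∧ A i ≤ M • (1 : H →L[ℂ] H)) :
    ∑ i, w i • A i ≤
      ((M + m) ^ 2 / (4 * M * m)) • Ring.inverse (∑ i, w i • Ring.inverse (A i)) := by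
  have hne : (Finset.univ : Finset (Fin n)).Nonempty :=
    Finset.nonempty_of_sum_ne_zero (hw.2.trans_ne one_ne_zero)
  have hS : IsPosDef (∑ i, w i • Ring.inverse (A i)) :=
    .sum hne fun i _ => (hA i).ringInverse.smul (hw.1 i)
  refine le_trans (le_sub_iff_add_le.2 ?_) (hS.smul_one_sub_smul_le_smul_inverse hm hM)
  calc
    _ = ∑ i, w i • (A i + (M * m) • Ring.inverse (A i)) := by
      simp only [smul_add, Finset.sum_add_distrib, Finset.smul_sum, smul_comm (w _)]
    _ ≤ ∑ i, w i • ((M + m) • (1 : H →L[ℂ] H)) := Finset.sum_le_sum fun i _ =>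
      smul_le_smul_of_nonneg_left ((hA i).add_smul_inverse_le (hbd i).1 (hbd i).2) (hw.1 i).le
    _ = _ := by rw [← Finset.sum_smul, hw.2, one_smul]

namespace OrderedMean

variable (G : OrderedMean H) {n k : ℕ} {w : Fin n → ℝ}

theorem add_le (hw : IsProbVec w) {A B : Fin n → H →L[ℂ] H} (hA : ∀ i, IsPosDef (A i))
    (hB : ∀ i, IsPosDef (B i)) :
    G.G n w A + G.G n w B ≤ G.G n w (fun i => A i + B i) := by
  have h2 : (0 : ℝ) < 2 := two_pos
  have h := G.concave n w (fun i => (2 : ℝ) • A i) (fun i => (2 : ℝ) • B i) (1 / 2) hw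
    (fun i => (hA i).smul h2) (fun i => (hB i).smul h2) (by norm_num) (by norm_num)
  rw [G.homog n w A 2 hw hA h2, G.homog n w B 2 hw hB h2] at h
  simp only [smul_smul] at h
  norm_num at h
  exact h

theorem apply_one (hw : IsProbVec w) : G.G n w (fun _ => 1) = 1 := by
  have h₁ := G.harm_le n w _ hw fun _ => IsPosDef.one
  have h₂ := G.le_arith n w _ hw fun _ => IsPosDef.one
  simp only [Ring.inverse_one, ← Finset.sum_smul, hw.2, one_smul] at h₁ h₂
  exact le_antisymm h₂ h₁

theorem add_smul_one_le (hw : IsProbVec w) {A : Fin n → H →L[ℂ] H} (hA : ∀ i, IsPosDef (A i))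
    {c : ℝ} (hc : 0 ≤ c) :
    G.G n w A + c • 1 ≤ G.G n w (fun i => A i + c • 1) := by
  obtain rfl | hc := hc.eq_or_lt
  · simp
  · have h := G.add_le hw hA fun _ => IsPosDef.one.smul hc
    rwa [G.homog n w _ c hw (fun _ => IsPosDef.one) hc, G.apply_one hw] at h

theorem sum_smul_le {ι : Type*} {s : Finset ι} (hs : s.Nonempty) {c : ι → ℝ}
    (hc : ∀ i ∈ s, 0 < c i) (hw : IsProbVec w) {A : ι → Fin n → H →L[ℂ] H}
    (hA : ∀ i j, IsPosDef (A i j)) :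
    ∑ i ∈ s, c i • G.G n w (A i) ≤ G.G n w (fun j => ∑ i ∈ s, c i • A i j) := by
  induction hs using Finset.Nonempty.cons_induction with
  | singleton a =>
    simp only [Finset.sum_singleton]
    exact (G.homog n w _ _ hw (hA a) (hc a (Finset.mem_singleton_self a))).ge
  | cons a s ha hs ih =>
    simp only [Finset.sum_cons]
    have hcs : ∀ i ∈ s, 0 < c i := fun i hi => hc i (Finset.mem_cons_of_mem hi)
    have hca : 0 < c a := hc a (Finset.mem_cons_self a s)
    rw [← G.homog n w _ _ hw (hA a) hca]
    exact (add_le_add_right (ih hcs) _).trans (G.add_le hw (fun j => (hA a j).smul hca)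
      fun j => .sum hs fun i hi => (hA i j).smul (hcs i hi))

theorem pMean_of_nonneg {c : ℝ} (hc : 0 ≤ c) (A : Fin n → H →L[ℂ] H) :
    G.pMean c n w A = G.G n w (fun i => A i + c • 1) - c • 1 :=
  if_pos hc

theorem le_pMean (hw : IsProbVec w) {A : Fin n → H →L[ℂ] H} (hA : ∀ i, IsPosDef (A i))
    {c : ℝ} (hc : 0 ≤ c) : G.G n w A ≤ G.pMean c n w A := by
  rw [G.pMean_of_nonneg hc, le_sub_iff_add_le]
  exact G.add_smul_one_le hw hA hc

theorem pMean_posDef (hw : IsProbVec w) {A : Fin n → H →L[ℂ] H} (hA : ∀ i, IsPosDef (A i))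
    {c : ℝ} (hc : 0 ≤ c) : IsPosDef (G.pMean c n w A) :=
  (G.posDef n w A hw hA).of_le (G.le_pMean hw hA hc)

theorem pMean_le_arith (hw : IsProbVec w) {A : Fin n → H →L[ℂ] H} (hA : ∀ i, IsPosDef (A i))
    {c : ℝ} (hc : 0 ≤ c) : G.pMean c n w A ≤ ∑ i, w i • A i := by
  rw [G.pMean_of_nonneg hc, sub_le_iff_le_add]
  refine (G.le_arith n w _ hw fun i => (hA i).add_smul_one hc).trans_eq ?_
  rw [Finset.sum_congr rfl fun i _ => smul_add (w i) (A i) (c • 1), Finset.sum_add_distrib,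
    ← Finset.sum_smul, hw.2, one_smul]

theorem pMean_mono (hw : IsProbVec w) {A B : Fin n → H →L[ℂ] H} (hA : ∀ i, IsPosDef (A i))
    (hB : ∀ i, IsPosDef (B i)) (h : ∀ i, A i ≤ B i) {c : ℝ} (hc : 0 ≤ c) :
    G.pMean c n w A ≤ G.pMean c n w B := by
  rw [G.pMean_of_nonneg hc, G.pMean_of_nonneg hc]
  exact sub_le_sub_right (G.mono n w _ _ hw (fun i => (hB i).add_smul_one hc)
    (fun i => (hA i).add_smul_one hc) fun i => add_le_add_left (h i) _) _

theorem pMean_smul_le (hw : IsProbVec w) {A : Fin n → H →L[ℂ] H} (hA : ∀ i, IsPosDef (A i))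
    {c : ℝ} (hc : 0 ≤ c) {K : ℝ} (hK : 1 ≤ K) :
    G.pMean c n w (fun i => K • A i) ≤ K • G.pMean c n w A := by
  have hK₀ : 0 < K := one_pos.trans_le hK
  have h := G.add_smul_one_le hw (fun i => ((hA i).smul hK₀).add_smul_one hc)
    (mul_nonneg (sub_nonneg.2 hK) hc)
  have heq : (fun i => K • A i + c • 1 + ((K - 1) * c) • 1) = fun i => K • (A i + c • 1) := by
    ext1 i
    module
  rw [heq, G.homog n w _ K hw (fun i => (hA i).add_smul_one hc) hK₀] at h
  rw [G.pMean_of_nonneg hc, G.pMean_of_nonneg hc, smul_sub]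
  calc
    _ = G.G n w (fun i => K • A i + c • 1) + ((K - 1) * c) • 1 - K • c • 1 := by module
    _ ≤ _ := sub_le_sub_right h _

/-- Joint concavity of the parameterized means in the parameter and the operators. -/
theorem sum_smul_pMean_le (hw : IsProbVec w) {l : Fin k → ℝ} (hl : IsProbVec l)
    {A : Fin n → Fin k → H →L[ℂ] H} (hA : ∀ i j, IsPosDef (A i j)) {μ : Fin n → ℝ}
    (hμ : ∀ i, 0 ≤ μ i) :
    ∑ i, w i • G.pMean (μ i) k l (A i) ≤
      G.pMean (∑ i, w i * μ i) k l (fun j => ∑ i, w i • A i j) := by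
  have hne : (Finset.univ : Finset (Fin n)).Nonempty :=
    Finset.nonempty_of_sum_ne_zero (hw.2.trans_ne one_ne_zero)
  have hμw : 0 ≤ ∑ i, w i * μ i := Finset.sum_nonneg fun i _ => mul_nonneg (hw.1 i).le (hμ i)
  have h := G.sum_smul_le hne (fun i _ => hw.1 i) hl fun i j => (hA i j).add_smul_one (hμ i)
  simp only [smul_add, Finset.sum_add_distrib, smul_smul, ← Finset.sum_smul] at h
  simp only [G.pMean_of_nonneg (hμ _), smul_sub, Finset.sum_sub_distrib, smul_smul,
    ← Finset.sum_smul]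
  rw [G.pMean_of_nonneg hμw]
  exact sub_le_sub_right h _

end OrderedMean

theorem pMean_mixture_kantorovich_nonneg (G : OrderedMean H) {n k : ℕ} (w : Fin n → ℝ) (l : Fin k → ℝ)
    (hw : IsProbVec w) (hl : IsProbVec l) (A : Fin n → Fin k → (H →L[ℂ] H))
    (hA : ∀ i j, IsPosDef (A i j)) (m M : ℝ) (hm : 0 < m) (hmM : m ≤ M)
    (hbd : ∀ i j, m • (1 : H →L[ℂ] H) ≤ A i j ∧ A i j ≤ M • (1 : H →L[ℂ] H))
    (μ : Fin n → ℝ) (ν : ℝ) (hμ : ∀ i, 0 ≤ μ i) (hν : 0 ≤ ν) :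
    G.pMean ν n w (fun i => G.pMean (μ i) k l (A i)) ≤
      ((M + m) ^ 2 / (4 * M * m)) • G.pMean (∑ i, w i * μ i) k l
        (fun j => G.pMean ν n w (fun i => A i j)) := by
  have hM : 0 < M := hm.trans_le hmM
  have hne : (Finset.univ : Finset (Fin n)).Nonempty :=
    Finset.nonempty_of_sum_ne_zero (hw.2.trans_ne one_ne_zero)
  have hμw : 0 ≤ ∑ i, w i * μ i := Finset.sum_nonneg fun i _ => mul_nonneg (hw.1 i).le (hμ i)
  have hK : 1 ≤ (M + m) ^ 2 / (4 * M * m) := by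
    rw [one_le_div (by positivity)]
    nlinarith [sq_nonneg (M - m)]
  have hG (j : Fin k) : IsPosDef (G.pMean ν n w (fun i => A i j)) :=
    G.pMean_posDef hw (fun i => hA i j) hν
  have hkant (j : Fin k) : ∑ i, w i • A i j ≤
      ((M + m) ^ 2 / (4 * M * m)) • G.pMean ν n w (fun i => A i j) :=
    (sum_smul_le_kantorovich_smul_harmonic hw (fun i => hA i j) hm hM fun i => hbd i j).trans
      (smul_le_smul_of_nonneg_left ((G.harm_le n w _ hw fun i => hA i j).trans
        (G.le_pMean hw (fun i => hA i j) hν)) (one_pos.le.trans hK))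
  calc
    _ ≤ ∑ i, w i • G.pMean (μ i) k l (A i) :=
      G.pMean_le_arith hw (fun i => G.pMean_posDef hl (hA i) (hμ i)) hν
    _ ≤ G.pMean (∑ i, w i * μ i) k l (fun j => ∑ i, w i • A i j) :=
      G.sum_smul_pMean_le hw hl hA hμ
    _ ≤ G.pMean (∑ i, w i * μ i) k l
        (fun j => ((M + m) ^ 2 / (4 * M * m)) • G.pMean ν n w (fun i => A i j)) :=
      G.pMean_mono hl (fun j => .sum hne fun i _ => (hA i j).smul (hw.1 i))
        (fun j => (hG j).smul (one_pos.trans_le hK)) hkant hμw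
    _ ≤ _ := G.pMean_smul_le hl hG hμw hK
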